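/- arXiv:2410.09669 — 9 statements merged into one kernel-verified Lean document; each statement's English description precedes it below -/
import Mathlib

section
/- Let ρ¹, ρ², u : ℝ² → ℝ be smooth functions of (t,x) with ρ¹ > 0 and ρ¹ + ρ² > 0 everywhere, satisfying the isothermal no-slip drift flux system S̃: ρ¹_t + u ρ¹_x + u_x ρ¹ = 0, ρ²_t + u ρ²_x + u_x ρ² = 0, (ρ¹+ρ²)(u_t + u u_x) + ρ¹_x + ρ²_x = 0. Then the Riemann invariants r¹ := (u + ln(ρ¹+ρ²))/2, r² := (u − ln(ρ¹+ρ²))/2, r³ := ρ²/ρ¹ satisfy the diagonal system S: r¹_t + (r¹+r²+1) r¹_x = 0, r²_t + (r¹+r²−1) r²_x = 0, r³_t + (r¹+r²) r³_x = 0. -/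
/-- Partial derivative with respect to the first variable `t`. -/
noncomputable def pt (f : ℝ → ℝ → ℝ) (t x : ℝ) : ℝ := deriv (fun s => f s x) t

/-- Partial derivative with respect to the second variable `x`. -/
noncomputable def px (f : ℝ → ℝ → ℝ) (t x : ℝ) : ℝ := deriv (fun s => f t s) x

theorem hasDerivAt_pt {f : ℝ → ℝ → ℝ} (hf : ContDiff ℝ (⊤ : ℕ∞) (Function.uncurry f)) (t x : ℝ) :
    HasDerivAt (fun s => f s x) (pt f t x) t := by
  have h : Differentiable ℝ (Function.uncurry f) := hf.differentiable (by simp)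
  have h' : Differentiable ℝ (fun s => Function.uncurry f (s, x)) := by fun_prop
  exact (h' t).hasDerivAt

theorem hasDerivAt_px {f : ℝ → ℝ → ℝ} (hf : ContDiff ℝ (⊤ : ℕ∞) (Function.uncurry f)) (t x : ℝ) :
    HasDerivAt (fun s => f t s) (px f t x) x := by
  have h : Differentiable ℝ (Function.uncurry f) := hf.differentiable (by simp)
  have h' : Differentiable ℝ (fun s => Function.uncurry f (t, s)) := by fun_prop
  exact (h' x).hasDerivAt

/-- If smooth `ρ¹ > 0`, `ρ¹ + ρ² > 0` and `u` solve the isothermal no-slip drift flux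
system `S̃`, then the Riemann invariants `r¹ = (u + ln(ρ¹+ρ²))/2`, `r² = (u − ln(ρ¹+ρ²))/2`,
`r³ = ρ²/ρ¹` solve the diagonal system `S`. -/
theorem riemann_invariants_solve_diagonal_system
    (ρ1 ρ2 u : ℝ → ℝ → ℝ)
    (hρ1 : ContDiff ℝ (⊤ : ℕ∞) (Function.uncurry ρ1))
    (hρ2 : ContDiff ℝ (⊤ : ℕ∞) (Function.uncurry ρ2))
    (hu : ContDiff ℝ (⊤ : ℕ∞) (Function.uncurry u))
    (hpos1 : ∀ t x, 0 < ρ1 t x)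
    (hpos12 : ∀ t x, 0 < ρ1 t x + ρ2 t x)
    (heq1 : ∀ t x, pt ρ1 t x + u t x * px ρ1 t x + px u t x * ρ1 t x = 0)
    (heq2 : ∀ t x, pt ρ2 t x + u t x * px ρ2 t x + px u t x * ρ2 t x = 0)
    (heq3 : ∀ t x, (ρ1 t x + ρ2 t x) * (pt u t x + u t x * px u t x)
        + px ρ1 t x + px ρ2 t x = 0) :
    let r1 : ℝ → ℝ → ℝ := fun t x => (u t x + Real.log (ρ1 t x + ρ2 t x)) / 2
    let r2 : ℝ → ℝ → ℝ := fun t x => (u t x - Real.log (ρ1 t x + ρ2 t x)) / 2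
    let r3 : ℝ → ℝ → ℝ := fun t x => ρ2 t x / ρ1 t x
    (∀ t x, pt r1 t x + (r1 t x + r2 t x + 1) * px r1 t x = 0) ∧
    (∀ t x, pt r2 t x + (r1 t x + r2 t x - 1) * px r2 t x = 0) ∧
    (∀ t x, pt r3 t x + (r1 t x + r2 t x) * px r3 t x = 0) := by
  intro r1 r2 r3
  have hsum : ∀ t x, r1 t x + r2 t x = u t x := fun t x => by simp only [r1, r2]; ring
  have hne1 : ∀ t x, ρ1 t x ≠ 0 := fun t x => (hpos1 t x).ne'
  have hne : ∀ t x, ρ1 t x + ρ2 t x ≠ 0 := fun t x => (hpos12 t x).ne'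
  have hlt (t x : ℝ) := ((hasDerivAt_pt hρ1 t x).fun_add (hasDerivAt_pt hρ2 t x)).log (hne t x)
  have hlx (t x : ℝ) := ((hasDerivAt_px hρ1 t x).fun_add (hasDerivAt_px hρ2 t x)).log (hne t x)
  have hcont : ∀ t x, (pt ρ1 t x + pt ρ2 t x) / (ρ1 t x + ρ2 t x)
      + u t x * ((px ρ1 t x + px ρ2 t x) / (ρ1 t x + ρ2 t x)) + px u t x = 0 := fun t x => by
    have := hne t x
    field_simp
    linear_combination heq1 t x + heq2 t x
  have hmom : ∀ t x, pt u t x + u t x * px u t x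
      + (px ρ1 t x + px ρ2 t x) / (ρ1 t x + ρ2 t x) = 0 := fun t x => by
    have := hne t x
    field_simp
    linear_combination heq3 t x
  refine ⟨fun t x => ?_, fun t x => ?_, fun t x => ?_⟩
  · have ht : pt r1 t x = _ := (((hasDerivAt_pt hu t x).fun_add (hlt t x)).div_const 2).deriv
    have hx : px r1 t x = _ := (((hasDerivAt_px hu t x).fun_add (hlx t x)).div_const 2).deriv
    rw [hsum, ht, hx]
    linear_combination (hmom t x + hcont t x) / 2
  · have ht : pt r2 t x = _ := (((hasDerivAt_pt hu t x).fun_sub (hlt t x)).div_const 2).deriv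
    have hx : px r2 t x = _ := (((hasDerivAt_px hu t x).fun_sub (hlx t x)).div_const 2).deriv
    rw [hsum, ht, hx]
    linear_combination (hmom t x - hcont t x) / 2
  · have ht : pt r3 t x = _ :=
      ((hasDerivAt_pt hρ2 t x).fun_div (hasDerivAt_pt hρ1 t x) (hne1 t x)).deriv
    have hx : px r3 t x = _ :=
      ((hasDerivAt_px hρ2 t x).fun_div (hasDerivAt_px hρ1 t x) (hne1 t x)).deriv
    have := hne1 t x
    rw [hsum, ht, hx]
    field_simp
    linear_combination ρ1 t x * heq2 t x - ρ2 t x * heq1 t x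
end

section
/- For nonnegative integers k, l, k', l', the functions u^k u^l and u^{k'} u^{l'} on ℝ² are equal if and only if (k,l) = (k',l') or (k,l) = (l',k'), where u^k(x,y) = exp(k x + k y/(1−2k)). Equivalently: k + l = k' + l' and k/(1−2k) + l/(1−2l) = k'/(1−2k') + l'/(1−2l') hold simultaneously if and only if (k,l) = (k',l') or (k,l) = (l',k'). -/
/-- For a nonnegative integer `k`, the solution `u^k(x,y) = exp(kx + ky/(1−2k))` of the
Klein–Gordon equation `Ψ_y − Ψ_x = 2 Ψ_{xy}`. -/
noncomputable def uk (k : ℕ) (x y : ℝ) : ℝ :=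
  Real.exp ((k : ℝ) * x + (k : ℝ) * y / (1 - 2 * (k : ℝ)))

theorem one_sub_two_mul_natCast_ne_zero (k : ℕ) : (1 - 2 * (k : ℝ)) ≠ 0 := by
  have h : (1 - 2 * (k : ℤ)) ≠ 0 := by omega
  exact_mod_cast h

theorem eq_or_swap_of_exponents_eq {k l k' l' : ℕ} (hx : (k : ℝ) + l = k' + l')
    (hy : (k : ℝ) / (1 - 2 * k) + l / (1 - 2 * l) =
      k' / (1 - 2 * k') + l' / (1 - 2 * l')) :
    (k, l) = (k', l') ∨ (k, l) = (l', k') := by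
  have hsum : k + l = k' + l' := by exact_mod_cast hx
  simp only [Prod.mk.injEq]
  by_cases hone : k + l = 1
  · omega
  have hone' : (k : ℝ) + l - 1 ≠ 0 := by
    rw [sub_ne_zero]
    exact_mod_cast hone
  have hl : (l : ℝ) = k' + l' - k := by linarith
  rw [div_add_div _ _ (one_sub_two_mul_natCast_ne_zero k) (one_sub_two_mul_natCast_ne_zero l),
    div_add_div _ _ (one_sub_two_mul_natCast_ne_zero k') (one_sub_two_mul_natCast_ne_zero l'),
    div_eq_div_iff
      (mul_ne_zero (one_sub_two_mul_natCast_ne_zero k) (one_sub_two_mul_natCast_ne_zero l))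
      (mul_ne_zero (one_sub_two_mul_natCast_ne_zero k') (one_sub_two_mul_natCast_ne_zero l'))]
    at hy
  have hprod : ((k : ℝ) + l - 1) * (((k : ℝ) - k') * (k - l')) = 0 := by
    rw [hl] at hy ⊢
    linear_combination (-1 / 4) * hy
  rcases mul_eq_zero.mp ((mul_eq_zero.mp hprod).resolve_left hone') with h | h
  · have hk : k = k' := by exact_mod_cast sub_eq_zero.mp h
    omega
  · have hk : k = l' := by exact_mod_cast sub_eq_zero.mp h
    omega

theorem uk_mul_uk (k l : ℕ) (x y : ℝ) :
    uk k x y * uk l x y = Real.exp (((k : ℝ) + l) * x +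
      ((k : ℝ) / (1 - 2 * k) + l / (1 - 2 * l)) * y) := by
  rw [uk, uk, ← Real.exp_add]
  congr 1
  ring

/-- For nonnegative integers `k, l, k', l'`, the functions `u^k u^l` and `u^{k'} u^{l'}`
coincide if and only if `(k,l) = (k',l')` or `(k,l) = (l',k')`; equivalently,
`k + l = k' + l'` and `k/(1−2k) + l/(1−2l) = k'/(1−2k') + l'/(1−2l')` hold simultaneously
if and only if `(k,l) = (k',l')` or `(k,l) = (l',k')`. -/
theorem uk_products_equal_iff (k l k' l' : ℕ) :
    ((∀ x y : ℝ, uk k x y * uk l x y = uk k' x y * uk l' x y) ↔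
      ((k, l) = (k', l') ∨ (k, l) = (l', k'))) ∧
    ((((k : ℝ) + (l : ℝ) = (k' : ℝ) + (l' : ℝ)) ∧
      ((k : ℝ) / (1 - 2 * (k : ℝ)) + (l : ℝ) / (1 - 2 * (l : ℝ)) =
        (k' : ℝ) / (1 - 2 * (k' : ℝ)) + (l' : ℝ) / (1 - 2 * (l' : ℝ)))) ↔
      ((k, l) = (k', l') ∨ (k, l) = (l', k'))) := by
  refine ⟨⟨fun h => ?_, ?_⟩, ⟨fun h => eq_or_swap_of_exponents_eq h.1 h.2, ?_⟩⟩
  · simp only [uk_mul_uk, Real.exp_eq_exp] at h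
    exact eq_or_swap_of_exponents_eq (by simpa using h 1 0) (by simpa using h 0 1)
  · simp only [Prod.mk.injEq]
    rintro (⟨rfl, rfl⟩ | ⟨rfl, rfl⟩) x y
    · rfl
    · exact mul_comm _ _
  · simp only [Prod.mk.injEq]
    rintro (⟨rfl, rfl⟩ | ⟨rfl, rfl⟩)
    · exact ⟨rfl, rfl⟩
    · exact ⟨add_comm _ _, add_comm _ _⟩
end

section
/- Let g : ℝ² → ℝ be a smooth solution of the Klein–Gordon equation g_y − g_x = 2 g_{xy}. Then the function J[g](x,y) := (x+y) g(x,y) − 2x g_x(x,y) + 2y g_y(x,y) is again a solution of the same Klein–Gordon equation. (In other words, the vector field 2x∂_x − 2y∂_y + (x+y)g∂_g is a Lie symmetry of the Klein–Gordon equation with characteristic J[g].) -/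
/-- Partial derivative with respect to the first variable `x`. -/
noncomputable def pdx (f : ℝ → ℝ → ℝ) (x y : ℝ) : ℝ := deriv (fun s => f s y) x

/-- Partial derivative with respect to the second variable `y`. -/
noncomputable def pdy (f : ℝ → ℝ → ℝ) (x y : ℝ) : ℝ := deriv (fun s => f x s) y

open Function

theorem hasDerivAt_pdx {f : ℝ → ℝ → ℝ} (hf : Differentiable ℝ (uncurry f)) (x y : ℝ) :
    HasDerivAt (fun s => f s y) (pdx f x y) x := by
  have h : Differentiable ℝ (fun s => uncurry f (s, y)) := by fun_prop
  exact (h x).hasDerivAt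

theorem hasDerivAt_pdy {f : ℝ → ℝ → ℝ} (hf : Differentiable ℝ (uncurry f)) (x y : ℝ) :
    HasDerivAt (fun s => f x s) (pdy f x y) y := by
  have h : Differentiable ℝ (fun s => uncurry f (x, s)) := by fun_prop
  exact (h y).hasDerivAt

theorem uncurry_pdx {f : ℝ → ℝ → ℝ} (hf : Differentiable ℝ (uncurry f)) :
    uncurry (pdx f) = fun p => fderiv ℝ (uncurry f) p (1, 0) := by
  ext ⟨x, y⟩
  exact ((hf (x, y)).hasFDerivAt.comp_hasDerivAt x
    ((hasDerivAt_id x).prodMk (hasDerivAt_const x y))).deriv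

theorem uncurry_pdy {f : ℝ → ℝ → ℝ} (hf : Differentiable ℝ (uncurry f)) :
    uncurry (pdy f) = fun p => fderiv ℝ (uncurry f) p (0, 1) := by
  ext ⟨x, y⟩
  exact ((hf (x, y)).hasFDerivAt.comp_hasDerivAt y
    ((hasDerivAt_const y x).prodMk (hasDerivAt_id y))).deriv

theorem ContDiff.uncurry_pdx {f : ℝ → ℝ → ℝ} (hf : ContDiff ℝ (⊤ : ℕ∞) (uncurry f)) :
    ContDiff ℝ (⊤ : ℕ∞) (uncurry (pdx f)) := by
  rw [_root_.uncurry_pdx (hf.differentiable (by simp))]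
  exact (hf.fderiv_right (by simp)).clm_apply contDiff_const

theorem ContDiff.uncurry_pdy {f : ℝ → ℝ → ℝ} (hf : ContDiff ℝ (⊤ : ℕ∞) (uncurry f)) :
    ContDiff ℝ (⊤ : ℕ∞) (uncurry (pdy f)) := by
  rw [_root_.uncurry_pdy (hf.differentiable (by simp))]
  exact (hf.fderiv_right (by simp)).clm_apply contDiff_const

/-- Mixed partial derivatives of a smooth function commute. -/
theorem pdy_pdx_comm {f : ℝ → ℝ → ℝ} (hf : ContDiff ℝ (⊤ : ℕ∞) (uncurry f)) :
    pdy (pdx f) = pdx (pdy f) := by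
  have hd : Differentiable ℝ (uncurry f) := hf.differentiable (by simp)
  have hd' : Differentiable ℝ (fderiv ℝ (uncurry f)) :=
    (hf.fderiv_right (m := (⊤ : ℕ∞)) (by simp)).differentiable (by simp)
  have happly (p v : ℝ × ℝ) : fderiv ℝ (fun q => fderiv ℝ (uncurry f) q v) p =
      (fderiv ℝ (fderiv ℝ (uncurry f)) p).flip v := by
    rw [fderiv_clm_apply (hd' p) (differentiableAt_const v)]
    simp
  ext x y
  change uncurry (pdy (pdx f)) (x, y) = uncurry (pdx (pdy f)) (x, y)
  rw [uncurry_pdy (hf.uncurry_pdx.differentiable (by simp)),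
    uncurry_pdx (hf.uncurry_pdy.differentiable (by simp)), uncurry_pdx hd, uncurry_pdy hd]
  simp only [happly, ContinuousLinearMap.flip_apply]
  exact (hf.contDiffAt.isSymmSndFDerivAt
    (by simpa using WithTop.coe_le_coe.2 (le_top : (2 : ℕ∞) ≤ ⊤))).eq _ _

/-- If a smooth `g` solves the Klein–Gordon equation `g_y − g_x = 2 g_{xy}`, then
`J[g](x,y) = (x+y) g − 2x g_x + 2y g_y` solves the same equation; i.e., the vector field
`2x∂_x − 2y∂_y + (x+y)g∂_g` is a Lie symmetry of the Klein–Gordon equation with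
characteristic `J[g]`. -/
theorem lie_symmetry_characteristic_solves_klein_gordon
    (g : ℝ → ℝ → ℝ) (hg : ContDiff ℝ (⊤ : ℕ∞) (Function.uncurry g))
    (hKG : ∀ x y, pdy g x y - pdx g x y = 2 * pdx (pdy g) x y) :
    let J : ℝ → ℝ → ℝ := fun x y =>
      (x + y) * g x y - 2 * x * pdx g x y + 2 * y * pdy g x y
    ∀ x y, pdy J x y - pdx J x y = 2 * pdx (pdy J) x y := by
  intro J x y
  have hgx := hg.uncurry_pdx
  have hgy := hg.uncurry_pdy
  have hgxy := hgy.uncurry_pdx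
  have hgyy := hgy.uncurry_pdy
  have dx {f : ℝ → ℝ → ℝ} (hf : ContDiff ℝ (⊤ : ℕ∞) (uncurry f)) (x y : ℝ) :=
    hasDerivAt_pdx (hf.differentiable (by simp)) x y
  have dy {f : ℝ → ℝ → ℝ} (hf : ContDiff ℝ (⊤ : ℕ∞) (uncurry f)) (x y : ℝ) :=
    hasDerivAt_pdy (hf.differentiable (by simp)) x y
  have hJx : pdx J x y = g x y + (x + y) * pdx g x y - 2 * pdx g x y
      - 2 * x * pdx (pdx g) x y + 2 * y * pdx (pdy g) x y := by
    refine ((((((hasDerivAt_id x).add_const y).mul (dx hg x y)).sub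
      (((hasDerivAt_id x).const_mul 2).mul (dx hgx x y))).add
      ((dx hgy x y).const_mul (2 * y))).congr_deriv ?_).deriv
    simp only [id]
    ring
  have hJy : pdy J = fun x y => g x y + (x + y) * pdy g x y - 2 * x * pdx (pdy g) x y
      + 2 * pdy g x y + 2 * y * pdy (pdy g) x y := by
    ext x y
    rw [← pdy_pdx_comm hg]
    refine ((((((hasDerivAt_id y).const_add x).mul (dy hg x y)).sub
      ((dy hgx x y).const_mul (2 * x))).add
      (((hasDerivAt_id y).const_mul 2).mul (dy hgy x y))).congr_deriv ?_).deriv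
    simp only [id]
    ring
  have hJyx : pdx (pdy J) x y = pdx g x y + pdy g x y + (x + y) * pdx (pdy g) x y
      - 2 * x * pdx (pdx (pdy g)) x y + 2 * y * pdx (pdy (pdy g)) x y := by
    rw [hJy]
    refine (((((((dx hg x y).add (((hasDerivAt_id x).add_const y).mul (dx hgy x y))).sub
      (((hasDerivAt_id x).const_mul 2).mul (dx hgxy x y))).add
      ((dx hgy x y).const_mul 2)).add
      ((dx hgyy x y).const_mul (2 * y)))).congr_deriv ?_).deriv
    simp only [id]
    ring
  have hKGx : pdx (pdy g) x y - pdx (pdx g) x y = 2 * pdx (pdx (pdy g)) x y := by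
    refine ((dx hgy x y).sub (dx hgx x y)).unique ?_
    exact ((dx hgxy x y).const_mul 2).congr_of_eventuallyEq (.of_forall fun s => hKG s y)
  have hKGy : pdy (pdy g) x y - pdx (pdy g) x y = 2 * pdx (pdy (pdy g)) x y := by
    rw [← pdy_pdx_comm hgy]
    nth_rw 1 [← pdy_pdx_comm hg]
    refine ((dy hgy x y).sub (dy hgx x y)).unique ?_
    exact ((dy hgxy x y).const_mul 2).congr_of_eventuallyEq (.of_forall fun s => hKG x s)
  rw [hJyx, hJx, hJy]
  linear_combination (x + y) * hKG x y - 2 * x * hKGx + 2 * y * hKGy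
end

section
/- For every real number k ≠ 1/2, the function v^k : ℝ² → ℝ defined by v^k(x,y) = ((1−2k)² x + y) · exp(k x + k y/(1−2k)) is a solution of the Klein–Gordon equation Ψ_y − Ψ_x = 2 Ψ_{xy}, and moreover v^k = (1−2k) J[u^k], where u^k(x,y) = exp(k x + k y/(1−2k)) and J[g] := (x+y)g − 2x g_x + 2y g_y. -/
/-- Derivative of an affine function times the exponential of an affine function. -/
theorem hasDerivAt_affine_mul_exp_affine (a b m n t : ℝ) :
    HasDerivAt (fun s => (a * s + b) * Real.exp (m * s + n))
      ((a + m * (a * t + b)) * Real.exp (m * t + n)) t := by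
  have affine (p q : ℝ) : HasDerivAt (fun s => p * s + q) p t := by
    simpa using ((hasDerivAt_id t).const_mul p).add_const q
  exact ((affine a b).mul (affine m n).exp).congr_deriv (by ring)

/-- The `x`-derivative of `(a x + b y + d) * exp (m x + n y)`. -/
theorem pdx_affine_mul_exp (a b d m n x y : ℝ) :
    pdx (fun x y => (a * x + b * y + d) * Real.exp (m * x + n * y)) x y =
      (a + m * (a * x + b * y + d)) * Real.exp (m * x + n * y) := by
  simpa only [pdx, add_assoc] using
    (hasDerivAt_affine_mul_exp_affine a (b * y + d) m (n * y) x).deriv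

/-- The `y`-derivative of `(a x + b y + d) * exp (m x + n y)`. -/
theorem pdy_affine_mul_exp (a b d m n x y : ℝ) :
    pdy (fun x y => (a * x + b * y + d) * Real.exp (m * x + n * y)) x y =
      (b + n * (a * x + b * y + d)) * Real.exp (m * x + n * y) := by
  simpa only [pdy, add_assoc, add_left_comm, add_comm] using
    (hasDerivAt_affine_mul_exp_affine b (a * x + d) n (m * x) y).deriv

/-- For every real `k ≠ 1/2`, the function `v^k(x,y) = ((1−2k)²x + y)·exp(kx + ky/(1−2k))`
solves the Klein–Gordon equation `Ψ_y − Ψ_x = 2 Ψ_{xy}`, and moreover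
`v^k = (1−2k) J[u^k]` where `u^k(x,y) = exp(kx + ky/(1−2k))` and
`J[g] = (x+y)g − 2x g_x + 2y g_y`. -/
theorem vk_solves_klein_gordon_and_eq_J (k : ℝ) (hk : k ≠ 1 / 2) :
    let U : ℝ → ℝ → ℝ := fun x y => Real.exp (k * x + k * y / (1 - 2 * k))
    let V : ℝ → ℝ → ℝ := fun x y => ((1 - 2 * k) ^ 2 * x + y) *
      Real.exp (k * x + k * y / (1 - 2 * k))
    let JU : ℝ → ℝ → ℝ := fun x y =>
      (x + y) * U x y - 2 * x * pdx U x y + 2 * y * pdy U x y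
    (∀ x y : ℝ, pdy V x y - pdx V x y = 2 * pdx (pdy V) x y) ∧
    (∀ x y : ℝ, V x y = (1 - 2 * k) * JU x y) := by
  intro U V JU
  have hc : 1 - 2 * k ≠ 0 := fun h => hk (by linarith)
  set c := 1 - 2 * k with c_def
  have hU : U = fun x y => (0 * x + 0 * y + 1) * Real.exp (k * x + k / c * y) := by
    funext x y
    simp only [U, ← c_def]
    ring_nf
  have hV : V = fun x y => (c ^ 2 * x + 1 * y + 0) * Real.exp (k * x + k / c * y) := by
    funext x y
    simp only [V, ← c_def]
    ring_nf
  have hVy : pdy V = fun x y => (k * c * x + k / c * y + 1) *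
      Real.exp (k * x + k / c * y) := by
    funext x y
    rw [hV, pdy_affine_mul_exp]
    field_simp
    ring
  have hk' : k = (1 - c) / 2 := by linarith
  refine ⟨fun x y => ?_, fun x y => ?_⟩
  · rw [hVy, pdx_affine_mul_exp, hV, pdx_affine_mul_exp, ← mul_assoc, ← sub_mul]
    congr 1
    clear_value c
    subst hk'
    field_simp
    ring
  · simp only [JU]
    rw [hU, pdx_affine_mul_exp, pdy_affine_mul_exp, hV]
    beta_reduce
    generalize Real.exp (k * x + k / c * y) = e
    clear_value c
    subst hk'
    field_simp
    ring
end

section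
/- Let Ψ : ℝ² → ℝ be a smooth solution of the Klein–Gordon equation Ψ_y − Ψ_x = 2 Ψ_{xy}, and suppose there exist real constants c, b, a such that (c/2) Ψ(x,y)² + b Ψ(x,y) + e^{x−y} − a = 0 for all (x,y) ∈ ℝ². Then c · Ψ_x(x,y) · Ψ_y(x,y) = 0 for all (x,y) ∈ ℝ². -/
/-- If a smooth solution `Ψ` of the Klein–Gordon equation `Ψ_y − Ψ_x = 2 Ψ_{xy}` satisfies
`(c/2)Ψ² + bΨ + e^{x−y} − a = 0` identically for some constants `c, b, a`, then
`c Ψ_x Ψ_y = 0` identically. -/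
theorem quadratic_constraint_forces_degenerate_gradient
    (Ψ : ℝ → ℝ → ℝ) (hΨ : ContDiff ℝ (⊤ : ℕ∞) (Function.uncurry Ψ))
    (hKG : ∀ x y : ℝ, pdy Ψ x y - pdx Ψ x y = 2 * pdx (pdy Ψ) x y)
    (c b a : ℝ)
    (h : ∀ x y : ℝ, c / 2 * (Ψ x y) ^ 2 + b * Ψ x y + Real.exp (x - y) - a = 0) :
    ∀ x y : ℝ, c * pdx Ψ x y * pdy Ψ x y = 0 := by
  have hd : Differentiable ℝ (Function.uncurry Ψ) := hΨ.differentiable (by simp)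
  have hx (x y : ℝ) : HasDerivAt (fun s => Ψ s y) (pdx Ψ x y) x := by
    have : Differentiable ℝ (fun s => Ψ s y) :=
      hd.comp (differentiable_id.prodMk (differentiable_const y))
    exact (this x).hasDerivAt
  have hy (x y : ℝ) : HasDerivAt (fun s => Ψ x s) (pdy Ψ x y) y := by
    have : Differentiable ℝ (fun s => Ψ x s) :=
      hd.comp ((differentiable_const x).prodMk differentiable_id)
    exact (this y).hasDerivAt
  have hEx (x y : ℝ) : HasDerivAt (fun s => Real.exp (s - y)) (Real.exp (x - y)) x := by
    simpa using ((hasDerivAt_id x).sub_const y).exp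
  have hEy (x y : ℝ) : HasDerivAt (fun s => Real.exp (x - s)) (-Real.exp (x - y)) y := by
    simpa using ((hasDerivAt_id y).const_sub x).exp
  have hx' (x y : ℝ) : (c * Ψ x y + b) * pdx Ψ x y = -Real.exp (x - y) := by
    have key := (((((hx x y).pow 2).const_mul (c / 2)).add ((hx x y).const_mul b)).add
      (hEx x y)).sub_const a
    have := key.unique ((hasDerivAt_const x (0 : ℝ)).congr_of_eventuallyEq
      (Filter.Eventually.of_forall fun s => h s y))
    norm_num at this
    linarith
  have hy' (x y : ℝ) : (c * Ψ x y + b) * pdy Ψ x y = Real.exp (x - y) := by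
    have key := (((((hy x y).pow 2).const_mul (c / 2)).add ((hy x y).const_mul b)).add
      (hEy x y)).sub_const a
    have := key.unique ((hasDerivAt_const y (0 : ℝ)).congr_of_eventuallyEq
      (Filter.Eventually.of_forall fun s => h x s))
    norm_num at this
    linarith
  have hne (x y : ℝ) : c * Ψ x y + b ≠ 0 := fun h0 =>
    (Real.exp_pos (x - y)).ne (by rw [← hy', h0, zero_mul])
  intro x y
  have hu : HasDerivAt (fun s => c * Ψ s y + b) (c * pdx Ψ x y) x :=
    ((hx x y).const_mul c).add_const b
  have hpdy : (fun s => pdy Ψ s y) = fun s => Real.exp (s - y) / (c * Ψ s y + b) := by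
    funext s
    rw [eq_div_iff (hne s y), mul_comm, hy']
  have hxy : HasDerivAt (fun s => pdy Ψ s y) (pdx (pdy Ψ) x y) x := by
    have : DifferentiableAt ℝ (fun s => pdy Ψ s y) x := by
      rw [hpdy]
      exact ((hEx x y).div hu (hne x y)).differentiableAt
    exact this.hasDerivAt
  have hprod := (hu.mul hxy).unique ((hEx x y).congr_of_eventuallyEq
    (Filter.Eventually.of_forall fun s => hy' s y))
  linear_combination hprod + (c * Ψ x y + b) / 2 * hKG x y - hy' x y / 2 + hx' x y / 2
end

section
/- Let c_{αk} be real numbers for α ∈ {1,2,3} and integers k ≥ 0. Assume that c_{1k}c_{1l} + c_{2k}c_{2l} − c_{3k}c_{3l} = 0 for every pair (k,l) of nonnegative integers with (k,l) ∉ {(0,0), (0,1), (1,0)}, and that c_{11}c_{10} + c_{21}c_{20} − c_{31}c_{30} = −1. Then c_{αk} = 0 for all α ∈ {1,2,3} and all k ≥ 2. -/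
/-- In signature `(2, 1)`, a null vector `(x, y, z)` orthogonal to a null vector `(a, b, d)` with
`d ≠ 0` is proportional to it. -/
lemma proportional_of_null_of_orthogonal {a b d x y z : ℝ} (hd : d ≠ 0)
    (h : a * a + b * b - d * d = 0) (h' : x * x + y * y - z * z = 0)
    (horth : a * x + b * y - d * z = 0) : d * x = a * z ∧ d * y = b * z := by
  have hdet : a * y - b * x = 0 := by
    have hsq : (a * y - b * x) ^ 2 = 0 := by
      linear_combination (x * x + y * y) * h + d * d * h' - (a * x + b * y + d * z) * horth
    exact pow_eq_zero_iff two_ne_zero |>.mp hsq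
  constructor
  · apply mul_left_cancel₀ hd
    linear_combination -x * h + a * horth - b * hdet
  · apply mul_left_cancel₀ hd
    linear_combination -y * h + b * horth + a * hdet

/-- If the coefficients `c_{αk}` (α ∈ {1,2,3}, k ≥ 0) satisfy
`c_{1k}c_{1l} + c_{2k}c_{2l} − c_{3k}c_{3l} = 0` for every regular pair
`(k,l) ∉ {(0,0),(0,1),(1,0)}` and `c_{11}c_{10} + c_{21}c_{20} − c_{31}c_{30} = −1`,
then `c_{αk} = 0` for all `α` and all `k ≥ 2`. -/
theorem series_coefficients_vanish
    (c : Fin 3 → ℕ → ℝ)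
    (hreg : ∀ k l : ℕ, (k, l) ≠ (0, 0) → (k, l) ≠ (0, 1) → (k, l) ≠ (1, 0) →
      c 0 k * c 0 l + c 1 k * c 1 l - c 2 k * c 2 l = 0)
    (h10 : c 0 1 * c 0 0 + c 1 1 * c 1 0 - c 2 1 * c 2 0 = -1) :
    ∀ (α : Fin 3) (k : ℕ), 2 ≤ k → c α k = 0 := by
  intro α k hk
  have h11 := hreg 1 1 (by simp) (by simp) (by simp)
  have h1k := hreg 1 k (by simp) (by simp) (by simp; omega)
  have hkk := hreg k k (by simp; omega) (by simp; omega) (by simp; omega)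
  have hk0 := hreg k 0 (by simp; omega) (by simp) (by simp; omega)
  have hd : c 2 1 ≠ 0 := by
    intro hd
    have ha : c 0 1 = 0 := by nlinarith [mul_self_nonneg (c 0 1), mul_self_nonneg (c 1 1)]
    have hb : c 1 1 = 0 := by nlinarith [mul_self_nonneg (c 0 1), mul_self_nonneg (c 1 1)]
    simp [ha, hb, hd] at h10
  obtain ⟨hx, hy⟩ := proportional_of_null_of_orthogonal hd h11 hkk h1k
  have hz : c 2 k = 0 := by
    linear_combination c 2 k * h10 - c 2 1 * hk0 + c 0 0 * hx + c 1 0 * hy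
  rw [hz, mul_zero] at hx hy
  fin_cases α
  · exact (mul_eq_zero.mp hx).resolve_left hd
  · exact (mul_eq_zero.mp hy).resolve_left hd
  · exact hz
end

section
/- Let ε₁ = ε₂ = 1, ε₃ = −1, and let c_α, b_{1α}, b_{2α}, b_{3α} (α = 1,2,3) be real constants satisfying ∑_α ε_α c_α² = 0, ∑_α ε_α c_α b_{1α} = 0, ∑_α ε_α c_α b_{2α} = 0 and ∑_α ε_α c_α b_{3α} = −1. Let Λ¹, Λ² : ℝ → ℝ be smooth functions of z, and define Φ^α(z) := b_{1α}Λ¹(z) + b_{2α}Λ²(z) + b_{3α} and Ψ^α(x,y) := c_α e^{x−y}. Then each Ψ^α is a solution of the Klein–Gordon equation Ψ_y − Ψ_x = 2Ψ_{xy}, and for all (x,y,z) ∈ ℝ³ the system holds: ∑_α ε_α (Φ^α(z) + Ψ^α(x,y)) Ψ^α_x(x,y) = −e^{x−y}, ∑_α ε_α (Φ^α(z) + Ψ^α(x,y)) Ψ^α_y(x,y) = e^{x−y}, and ∑_α ε_α Ψ^α_x(x,y) Ψ^α_y(x,y) = 0. -/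
/-- The `x`-derivative of `a * exp (x - y)` is itself. -/
theorem pdx_const_mul_exp_sub (a : ℝ) :
    pdx (fun x y => a * Real.exp (x - y)) = fun x y => a * Real.exp (x - y) := by
  funext x y
  simp [pdx]

/-- The `y`-derivative of `a * exp (x - y)` is its negative. -/
theorem pdy_const_mul_exp_sub (a : ℝ) :
    pdy (fun x y => a * Real.exp (x - y)) = fun x y => -a * Real.exp (x - y) := by
  funext x y
  simpa [pdy] using ((((hasDerivAt_id y).const_sub x).exp).const_mul a).deriv

/-- For `ε₁ = ε₂ = 1`, `ε₃ = −1` and constants `c_α, b_{1α}, b_{2α}, b_{3α}` with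
`∑ ε_α c_α² = 0`, `∑ ε_α c_α b_{1α} = 0`, `∑ ε_α c_α b_{2α} = 0`,
`∑ ε_α c_α b_{3α} = −1`, define `Φ^α = b_{1α}Λ¹ + b_{2α}Λ² + b_{3α}` and
`Ψ^α = c_α e^{x−y}`. Then each `Ψ^α` solves the Klein–Gordon equation
`Ψ_y − Ψ_x = 2Ψ_{xy}` and the Gauss-equation constraints
`∑ ε_α (Φ^α + Ψ^α) Ψ^α_x = −e^{x−y}`, `∑ ε_α (Φ^α + Ψ^α) Ψ^α_y = e^{x−y}`,
`∑ ε_α Ψ^α_x Ψ^α_y = 0` hold for all `(x,y,z)`. -/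
theorem explicit_affinor_data_satisfies_constraints
    (ε : Fin 3 → ℝ) (hε0 : ε 0 = 1) (hε1 : ε 1 = 1) (hε2 : ε 2 = -1)
    (c b1 b2 b3 : Fin 3 → ℝ)
    (hc : ∑ α : Fin 3, ε α * (c α) ^ 2 = 0)
    (hb1 : ∑ α : Fin 3, ε α * c α * b1 α = 0)
    (hb2 : ∑ α : Fin 3, ε α * c α * b2 α = 0)
    (hb3 : ∑ α : Fin 3, ε α * c α * b3 α = -1)
    (Λ1 Λ2 : ℝ → ℝ) (hΛ1 : ContDiff ℝ (⊤ : ℕ∞) Λ1) (hΛ2 : ContDiff ℝ (⊤ : ℕ∞) Λ2) :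
    let Φ : Fin 3 → ℝ → ℝ := fun α z => b1 α * Λ1 z + b2 α * Λ2 z + b3 α
    let Ψ : Fin 3 → ℝ → ℝ → ℝ := fun α x y => c α * Real.exp (x - y)
    (∀ (α : Fin 3) (x y : ℝ),
      pdy (Ψ α) x y - pdx (Ψ α) x y = 2 * pdx (pdy (Ψ α)) x y) ∧
    (∀ x y z : ℝ, ∑ α : Fin 3, ε α * (Φ α z + Ψ α x y) * pdx (Ψ α) x y
      = -Real.exp (x - y)) ∧
    (∀ x y z : ℝ, ∑ α : Fin 3, ε α * (Φ α z + Ψ α x y) * pdy (Ψ α) x y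
      = Real.exp (x - y)) ∧
    (∀ x y : ℝ, ∑ α : Fin 3, ε α * pdx (Ψ α) x y * pdy (Ψ α) x y = 0) := by
  intro Φ Ψ
  have hx (α : Fin 3) : pdx (Ψ α) = fun x y => c α * Real.exp (x - y) :=
    pdx_const_mul_exp_sub (c α)
  have hy (α : Fin 3) : pdy (Ψ α) = fun x y => -c α * Real.exp (x - y) :=
    pdy_const_mul_exp_sub (c α)
  simp only [hx, hy, pdx_const_mul_exp_sub, Φ, Ψ]
  simp only [Fin.sum_univ_three, hε0, hε1, hε2] at *
  refine ⟨fun α x y => by ring, fun x y z => ?_, fun x y z => ?_, fun x y => ?_⟩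
  · linear_combination Real.exp (x - y) * (Λ1 z * hb1 + Λ2 z * hb2 + hb3 + Real.exp (x - y) * hc)
  · linear_combination -Real.exp (x - y) * (Λ1 z * hb1 + Λ2 z * hb2 + hb3 + Real.exp (x - y) * hc)
  · linear_combination -Real.exp (x - y) ^ 2 * hc
end

section
/- Let Φ¹, Φ², Φ³ : ℝ → ℝ be functions of z, Ψ¹, Ψ², Ψ³ : ℝ² → ℝ functions of (x,y), ε_α ∈ {−1,1}, and a₀, a₁, a₂, a₃ real constants such that ∑_{α=1}^3 ε_α Φ^α(z)(Ψ^α(x,y) − a_α) + ∑_{α=1}^3 (ε_α/2) Ψ^α(x,y)² + e^{x−y} − a₀ = 0 for all (x,y,z) ∈ ℝ³. Then the four functions Φ¹, Φ², Φ³ and the constant function 1 are linearly dependent over ℝ (i.e., dim span⟨Φ¹, Φ², Φ³, 1⟩ ≤ 3). -/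
/-- If `ε_α ∈ {−1,1}` and
`∑ ε_α Φ^α(z)(Ψ^α(x,y) − a_α) + ∑ (ε_α/2) Ψ^α(x,y)² + e^{x−y} − a₀ = 0` for all
`(x,y,z)`, then the functions `Φ¹, Φ², Φ³` and the constant function `1` are linearly
dependent over `ℝ`, i.e., `dim span⟨Φ¹, Φ², Φ³, 1⟩ ≤ 3`. -/
theorem Phi_and_one_linearly_dependent
    (ε : Fin 3 → ℝ) (hε : ∀ α, ε α = 1 ∨ ε α = -1)
    (Φ : Fin 3 → ℝ → ℝ) (Ψ : Fin 3 → ℝ → ℝ → ℝ)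
    (a0 : ℝ) (a : Fin 3 → ℝ)
    (h : ∀ x y z : ℝ,
      (∑ α : Fin 3, ε α * Φ α z * (Ψ α x y - a α))
        + (∑ α : Fin 3, ε α / 2 * (Ψ α x y) ^ 2) + Real.exp (x - y) - a0 = 0) :
    ∃ (l0 : ℝ) (l : Fin 3 → ℝ), (l0 ≠ 0 ∨ l ≠ 0) ∧
      ∀ z : ℝ, (∑ α : Fin 3, l α * Φ α z) + l0 = 0 := by
  have he : Real.exp 0 < Real.exp 1 := Real.exp_lt_exp.mpr one_pos
  refine ⟨(∑ α : Fin 3, ε α / 2 * ((Ψ α 1 0) ^ 2 - (Ψ α 0 0) ^ 2)) + Real.exp 1 - Real.exp 0,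
    fun α => ε α * (Ψ α 1 0 - Ψ α 0 0), ?_, fun z => ?_⟩
  · by_contra! hzero
    obtain ⟨h0, hl⟩ := hzero
    have hΨ : ∀ α, Ψ α 1 0 = Ψ α 0 0 := fun α => by
      have hε0 : ε α ≠ 0 := by rcases hε α with hα | hα <;> simp [hα]
      exact sub_eq_zero.mp ((mul_eq_zero.mp (congrFun hl α)).resolve_left hε0)
    simp only [hΨ, sub_self, mul_zero, Finset.sum_const_zero] at h0
    linarith
  · have h1 := h 1 0 z
    have h2 := h 0 0 z
    simp only [Fin.sum_univ_three, sub_zero] at h1 h2 ⊢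
    linear_combination h1 - h2
end

section
/- Let Θ : ℝ → ℝ be smooth and r = (r¹,r²,r³) : ℝ → ℝ³ a smooth function of x. Define, for a smooth ξ = (ξ₁,ξ₂,ξ₃) : ℝ → ℝ³, the operator H¹_Θ by (H¹_Θ ξ)¹ = e^{r²−r¹}(−ξ₁' − ½((r²' − r¹')ξ₁ + (r¹' − r²')ξ₂ − 2r³' ξ₃)), (H¹_Θ ξ)² = e^{r²−r¹}(ξ₂' − ½((r²' − r¹')ξ₁ + (r¹' − r²')ξ₂ − 2r³' ξ₃)), (H¹_Θ ξ)³ = e^{r²−r¹}(e^{r²−r¹}Θ(r³)ξ₃' − ½(2r³' ξ₁ + 2r³' ξ₂ + f³³ ξ₃)), where f³³ = −e^{r²−r¹}(2(r²' − r¹')Θ(r³) + r³' Θ'(r³)) and primes denote d/dx. Then H¹_Θ is formally skew-adjoint: for all smooth compactly supported λ, μ : ℝ → ℝ³, ∫_ℝ ∑_{i=1}^3 λ_i (H¹_Θ μ)^i dx = − ∫_ℝ ∑_{i=1}^3 μ_i (H¹_Θ λ)^i dx. -/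
open MeasureTheory

/-- The local Hamiltonian operator `H¹_Θ` of hydrodynamic type, applied to a triple
`ξ = (ξ₁,ξ₂,ξ₃)` of functions of `x`, on the background `r = (r¹,r²,r³)`:
`H¹_Θ = e^{r²−r¹}( diag(−1, 1, e^{r²−r¹}Θ(r³)) D_x − ½ M )` with
`M` having rows `(r²_x−r¹_x, r¹_x−r²_x, −2r³_x)`, `(r²_x−r¹_x, r¹_x−r²_x, −2r³_x)`,
`(2r³_x, 2r³_x, f³³)` and `f³³ = −e^{r²−r¹}(2(r²_x−r¹_x)Θ(r³) + r³_x Θ'(r³))`. -/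
noncomputable def Hop (Θ r1 r2 r3 ξ1 ξ2 ξ3 : ℝ → ℝ) : Fin 3 → ℝ → ℝ := fun i x =>
  let E := Real.exp (r2 x - r1 x)
  let f33 := -E * (2 * (deriv r2 x - deriv r1 x) * Θ (r3 x)
    + deriv r3 x * deriv Θ (r3 x))
  match i with
  | 0 => E * (-(deriv ξ1 x) - (1 / 2) * ((deriv r2 x - deriv r1 x) * ξ1 x
      + (deriv r1 x - deriv r2 x) * ξ2 x - 2 * deriv r3 x * ξ3 x))
  | 1 => E * (deriv ξ2 x - (1 / 2) * ((deriv r2 x - deriv r1 x) * ξ1 x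
      + (deriv r1 x - deriv r2 x) * ξ2 x - 2 * deriv r3 x * ξ3 x))
  | 2 => E * (E * Θ (r3 x) * deriv ξ3 x - (1 / 2) * (2 * deriv r3 x * ξ1 x
      + 2 * deriv r3 x * ξ2 x + f33 * ξ3 x))

/-- The pairing `∑ᵢ lᵢ (H¹_Θ m)ⁱ` is integrable when `l` is continuous and compactly supported. -/
theorem integrable_sum_mul_Hop {Θ r1 r2 r3 l1 l2 l3 m1 m2 m3 : ℝ → ℝ}
    (hΘ : ContDiff ℝ 1 Θ) (hr1 : ContDiff ℝ 1 r1) (hr2 : ContDiff ℝ 1 r2) (hr3 : ContDiff ℝ 1 r3)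
    (hl1 : Continuous l1) (hl2 : Continuous l2) (hl3 : Continuous l3)
    (hm1 : ContDiff ℝ 1 m1) (hm2 : ContDiff ℝ 1 m2) (hm3 : ContDiff ℝ 1 m3)
    (hsl1 : HasCompactSupport l1) (hsl2 : HasCompactSupport l2) (hsl3 : HasCompactSupport l3) :
    Integrable fun x => l1 x * Hop Θ r1 r2 r3 m1 m2 m3 0 x
      + l2 x * Hop Θ r1 r2 r3 m1 m2 m3 1 x + l3 x * Hop Θ r1 r2 r3 m1 m2 m3 2 x := by
  have cΘ := hΘ.continuous
  have c1 := hr1.continuous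
  have c2 := hr2.continuous
  have c3 := hr3.continuous
  have d1 := hm1.continuous
  have d2 := hm2.continuous
  have d3 := hm3.continuous
  have cΘ' := hΘ.continuous_deriv le_rfl
  have c1' := hr1.continuous_deriv le_rfl
  have c2' := hr2.continuous_deriv le_rfl
  have c3' := hr3.continuous_deriv le_rfl
  have d1' := hm1.continuous_deriv le_rfl
  have d2' := hm2.continuous_deriv le_rfl
  have d3' := hm3.continuous_deriv le_rfl
  have h0 : Continuous (Hop Θ r1 r2 r3 m1 m2 m3 0) := by unfold Hop; fun_prop
  have h1 : Continuous (Hop Θ r1 r2 r3 m1 m2 m3 1) := by unfold Hop; fun_prop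
  have h2 : Continuous (Hop Θ r1 r2 r3 m1 m2 m3 2) := by unfold Hop; fun_prop
  exact (((hl1.mul h0).integrable_of_hasCompactSupport hsl1.mul_right).add
    ((hl2.mul h1).integrable_of_hasCompactSupport hsl2.mul_right)).add
    ((hl3.mul h2).integrable_of_hasCompactSupport hsl3.mul_right)

/-- The symmetrized pairing of `H¹_Θ` is the total derivative of the quadratic form given by its
leading coefficients. -/
theorem hasDerivAt_Hop_form {Θ r1 r2 r3 l1 l2 l3 m1 m2 m3 : ℝ → ℝ}
    (hΘ : Differentiable ℝ Θ) (hr1 : Differentiable ℝ r1) (hr2 : Differentiable ℝ r2)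
    (hr3 : Differentiable ℝ r3)
    (hl1 : Differentiable ℝ l1) (hl2 : Differentiable ℝ l2) (hl3 : Differentiable ℝ l3)
    (hm1 : Differentiable ℝ m1) (hm2 : Differentiable ℝ m2) (hm3 : Differentiable ℝ m3) (x : ℝ) :
    HasDerivAt (fun x => l1 x * (-Real.exp (r2 x - r1 x) * m1 x)
        + l2 x * (Real.exp (r2 x - r1 x) * m2 x)
        + l3 x * (Real.exp (r2 x - r1 x) * Real.exp (r2 x - r1 x) * Θ (r3 x) * m3 x))
      ((l1 x * Hop Θ r1 r2 r3 m1 m2 m3 0 x + l2 x * Hop Θ r1 r2 r3 m1 m2 m3 1 x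
          + l3 x * Hop Θ r1 r2 r3 m1 m2 m3 2 x)
        + (m1 x * Hop Θ r1 r2 r3 l1 l2 l3 0 x + m2 x * Hop Θ r1 r2 r3 l1 l2 l3 1 x
          + m3 x * Hop Θ r1 r2 r3 l1 l2 l3 2 x)) x := by
  have hE := ((hr2 x).hasDerivAt.sub (hr1 x).hasDerivAt).exp
  have hT := (hΘ (r3 x)).hasDerivAt.comp x (hr3 x).hasDerivAt
  have h := (((hl1 x).hasDerivAt.mul (hE.neg.mul (hm1 x).hasDerivAt)).add
    ((hl2 x).hasDerivAt.mul (hE.mul (hm2 x).hasDerivAt))).add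
    ((hl3 x).hasDerivAt.mul (((hE.mul hE).mul hT).mul (hm3 x).hasDerivAt))
  refine h.congr_deriv ?_
  simp only [Hop, Pi.mul_apply, Pi.neg_apply, Pi.sub_apply, Function.comp_apply]
  ring

/-- The operator `H¹_Θ` is formally skew-adjoint: for all smooth compactly supported
`λ, μ : ℝ → ℝ³`, `∫ ∑ᵢ λᵢ (H¹_Θ μ)ⁱ dx = − ∫ ∑ᵢ μᵢ (H¹_Θ λ)ⁱ dx`. -/
theorem Hop_formally_skew_adjoint
    (Θ r1 r2 r3 : ℝ → ℝ)
    (hΘ : ContDiff ℝ (⊤ : ℕ∞) Θ) (hr1 : ContDiff ℝ (⊤ : ℕ∞) r1)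
    (hr2 : ContDiff ℝ (⊤ : ℕ∞) r2) (hr3 : ContDiff ℝ (⊤ : ℕ∞) r3)
    (l1 l2 l3 m1 m2 m3 : ℝ → ℝ)
    (hl1 : ContDiff ℝ (⊤ : ℕ∞) l1) (hl2 : ContDiff ℝ (⊤ : ℕ∞) l2) (hl3 : ContDiff ℝ (⊤ : ℕ∞) l3)
    (hm1 : ContDiff ℝ (⊤ : ℕ∞) m1) (hm2 : ContDiff ℝ (⊤ : ℕ∞) m2) (hm3 : ContDiff ℝ (⊤ : ℕ∞) m3)
    (hsl1 : HasCompactSupport l1) (hsl2 : HasCompactSupport l2)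
    (hsl3 : HasCompactSupport l3)
    (hsm1 : HasCompactSupport m1) (hsm2 : HasCompactSupport m2)
    (hsm3 : HasCompactSupport m3) :
    ∫ x : ℝ, (l1 x * Hop Θ r1 r2 r3 m1 m2 m3 0 x
      + l2 x * Hop Θ r1 r2 r3 m1 m2 m3 1 x
      + l3 x * Hop Θ r1 r2 r3 m1 m2 m3 2 x)
    = - ∫ x : ℝ, (m1 x * Hop Θ r1 r2 r3 l1 l2 l3 0 x
      + m2 x * Hop Θ r1 r2 r3 l1 l2 l3 1 x
      + m3 x * Hop Θ r1 r2 r3 l1 l2 l3 2 x) := by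
  have h1 : (1 : WithTop ℕ∞) ≤ ((⊤ : ℕ∞) : WithTop ℕ∞) := by exact_mod_cast le_top
  have h0 : ((⊤ : ℕ∞) : WithTop ℕ∞) ≠ 0 := by simp
  have hlm := integrable_sum_mul_Hop (hΘ.of_le h1) (hr1.of_le h1) (hr2.of_le h1) (hr3.of_le h1)
    hl1.continuous hl2.continuous hl3.continuous (hm1.of_le h1) (hm2.of_le h1) (hm3.of_le h1)
    hsl1 hsl2 hsl3
  have hml := integrable_sum_mul_Hop (hΘ.of_le h1) (hr1.of_le h1) (hr2.of_le h1) (hr3.of_le h1)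
    hm1.continuous hm2.continuous hm3.continuous (hl1.of_le h1) (hl2.of_le h1) (hl3.of_le h1)
    hsm1 hsm2 hsm3
  rw [eq_neg_iff_add_eq_zero, ← integral_add hlm hml]
  refine integral_eq_zero_of_hasDerivAt_of_integrable
    (hasDerivAt_Hop_form (hΘ.differentiable h0) (hr1.differentiable h0) (hr2.differentiable h0)
      (hr3.differentiable h0) (hl1.differentiable h0) (hl2.differentiable h0)
      (hl3.differentiable h0) (hm1.differentiable h0) (hm2.differentiable h0)
      (hm3.differentiable h0)) (hlm.add hml) ?_
  have cΘ := hΘ.continuous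
  have c1 := hr1.continuous
  have c2 := hr2.continuous
  have c3 := hr3.continuous
  have d1 := hm1.continuous
  have d2 := hm2.continuous
  have d3 := hm3.continuous
  exact (((hl1.continuous.mul (by fun_prop)).integrable_of_hasCompactSupport hsl1.mul_right).add
    ((hl2.continuous.mul (by fun_prop)).integrable_of_hasCompactSupport hsl2.mul_right)).add
    ((hl3.continuous.mul (by fun_prop)).integrable_of_hasCompactSupport hsl3.mul_right)
end
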